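/- arXiv:2107.08829 — 4 statements merged into one kernel-verified Lean document; each statement's English description precedes it below -/
import Mathlib

section
/- Let S and A be finite nonempty types, let γ ∈ [0,1), let α ≥ 0 and R_max ≥ 0. Let π : S → (A → ℝ) assign to each state s a pmf π s on A (the policy), let T : S → A → (S → ℝ) assign to each (s,a) a pmf T s a on S (the true dynamics), and let T̂ : S → A → (S → ℝ) assign to each (s,a) a pmf T̂ s a on S (the learned model), with TV(T s a, T̂ s a) ≤ α for all s, a. Let μ₀ be a pmf on S. Define the true state marginals by μ_0 = μ₀ and μ_{t+1}(s') = ∑_{s,a} μ_t(s)·π s a·T s a s', the true state-action marginals ν_t(s,a) = μ_t(s)·π s a, and analogously the model marginals μ̂_t, ν̂_t using T̂ in place of T with μ̂_0 = μ₀. Define the discounted visitation distributions ρ(s,a) = (1−γ)·∑'_{t∈ℕ} γ^t·ν_t(s,a) and ρ̂(s,a) = (1−γ)·∑'_{t∈ℕ} γ^t·ν̂_t(s,a). Let ρ_E be any pmf on S × A (the expert visitation distribution) and let r : S × A → ℝ satisfy 0 ≤ r(s,a) ≤ R_max for all (s,a). Define J = (1−γ)⁻¹·∑_{s,a} ρ(s,a)·r(s,a)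 and J_E = (1−γ)⁻¹·∑_{s,a} ρ_E(s,a)·r(s,a). Then |J_E − J| ≤ (R_max/(1−γ))·TV(ρ̂, ρ_E) + α·R_max/(1−γ)². -/
open Finset

/-- `p` is a probability mass function on the finite type `S`. -/
def IsPmf {S : Type*} [Fintype S] (p : S → ℝ) : Prop :=
  (∀ s, 0 ≤ p s) ∧ ∑ s, p s = 1

/-- Total variation distance between two pmfs on a finite type. -/
noncomputable def TV {S : Type*} [Fintype S] (p q : S → ℝ) : ℝ :=
  (1 / 2) * ∑ s, |p s - q s|

theorem TV_triangle {X : Type*} [Fintype X] (p q w : X → ℝ) :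
    TV p w ≤ TV p q + TV q w := by
  unfold TV
  rw [← mul_add, ← sum_add_distrib]
  gcongr
  exact abs_sub_le _ _ _

theorem TV_comm {X : Type*} [Fintype X] (p q : X → ℝ) : TV p q = TV q p := by
  simp only [TV, abs_sub_comm]

/-- Expectations of a function with values in `[0, R]` differ by at most `R` times the total
variation distance. -/
theorem abs_sum_mul_sub_sum_mul_le {X : Type*} [Fintype X] {p q r : X → ℝ} {R : ℝ}
    (hpq : ∑ x, p x = ∑ x, q x) (hr : ∀ x, 0 ≤ r x ∧ r x ≤ R) :
    |∑ x, p x * r x - ∑ x, q x * r x| ≤ R * TV p q := by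
  have hcenter : ∑ x, p x * r x - ∑ x, q x * r x = ∑ x, (p x - q x) * (r x - R / 2) := by
    simp only [sub_mul, mul_sub, sum_sub_distrib, ← sum_mul, hpq]
    ring
  rw [hcenter, TV, ← mul_assoc, mul_sum]
  refine (abs_sum_le_sum_abs _ _).trans (sum_le_sum fun x _ => ?_)
  rw [abs_mul, mul_comm]
  gcongr
  rw [abs_le]
  constructor <;> linarith [(hr x).1, (hr x).2]

theorem IsPmf.bind {X Y : Type*} [Fintype X] [Fintype Y] {p : X → ℝ} {K : X → Y → ℝ}
    (hp : IsPmf p) (hK : ∀ x, IsPmf (K x)) : IsPmf fun y => ∑ x, p x * K x y := by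
  refine ⟨fun y => sum_nonneg fun x _ => mul_nonneg (hp.1 x) ((hK x).1 y), ?_⟩
  rw [sum_comm]
  simp only [← mul_sum, (hK _).2, mul_one, hp.2]

theorem IsPmf.joint {S A : Type*} [Fintype S] [Fintype A] {p : S → ℝ} {π : S → A → ℝ}
    (hp : IsPmf p) (hπ : ∀ s, IsPmf (π s)) : IsPmf fun x : S × A => p x.1 * π x.1 x.2 := by
  refine ⟨fun x => mul_nonneg (hp.1 _) ((hπ _).1 _), ?_⟩
  simp only [Fintype.sum_prod_type, ← mul_sum, (hπ _).2, mul_one, hp.2]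

theorem TV_joint {S A : Type*} [Fintype S] [Fintype A] (p q : S → ℝ) {π : S → A → ℝ}
    (hπ : ∀ s, IsPmf (π s)) :
    TV (fun x : S × A => p x.1 * π x.1 x.2) (fun x => q x.1 * π x.1 x.2) = TV p q := by
  simp only [TV, Fintype.sum_prod_type, ← sub_mul, abs_mul, ← mul_sum,
    abs_of_nonneg ((hπ _).1 _), (hπ _).2, mul_one]

theorem TV_bind_le {X Y : Type*} [Fintype X] [Fintype Y] {p q : X → ℝ} {K L : X → Y → ℝ} {α : ℝ}
    (hp : IsPmf p) (hL : ∀ x, IsPmf (L x)) (hKL : ∀ x, TV (K x) (L x) ≤ α) :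
    TV (fun y => ∑ x, p x * K x y) (fun y => ∑ x, q x * L x y) ≤ TV p q + α := by
  have hpoint : ∀ y, |∑ x, p x * K x y - ∑ x, q x * L x y| ≤
      ∑ x, (|p x - q x| * L x y + p x * |K x y - L x y|) := fun y => by
    rw [← sum_sub_distrib]
    refine (abs_sum_le_sum_abs _ _).trans (sum_le_sum fun x _ => ?_)
    calc |p x * K x y - q x * L x y|
        = |(p x - q x) * L x y + p x * (K x y - L x y)| := by ring_nf
      _ ≤ _ := abs_add_le _ _
      _ = _ := by rw [abs_mul, abs_mul, abs_of_nonneg ((hL x).1 y), abs_of_nonneg (hp.1 x)]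
  calc TV (fun y => ∑ x, p x * K x y) (fun y => ∑ x, q x * L x y)
      ≤ 1 / 2 * ∑ y, ∑ x, (|p x - q x| * L x y + p x * |K x y - L x y|) := by
        unfold TV
        gcongr with y
        exact hpoint y
    _ = TV p q + ∑ x, p x * TV (K x) (L x) := by
        rw [sum_comm]
        simp only [sum_add_distrib, ← mul_sum, (hL _).2, mul_one, mul_add, TV]
        congr 1
        rw [mul_sum]
        exact sum_congr rfl fun x _ => by ring
    _ ≤ TV p q + ∑ x, p x * α := by
        gcongr with x
        · exact hp.1 x
        · exact hKL x
    _ = TV p q + α := by rw [← sum_mul, hp.2, one_mul]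

theorem IsPmf.le_one {X : Type*} [Fintype X] {p : X → ℝ} (hp : IsPmf p) (x : X) : p x ≤ 1 :=
  hp.2 ▸ single_le_sum (fun y _ => hp.1 y) (mem_univ x)

theorem IsPmf.summable_discounted {X : Type*} [Fintype X] {γ : ℝ} (hγ0 : 0 ≤ γ) (hγ1 : γ < 1)
    {p : ℕ → X → ℝ} (hp : ∀ t, IsPmf (p t)) (x : X) : Summable fun t => γ ^ t * p t x :=
  (summable_geometric_of_lt_one hγ0 hγ1).of_nonneg_of_le
    (fun t => mul_nonneg (pow_nonneg hγ0 t) ((hp t).1 x))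
    (fun t => mul_le_of_le_one_right (pow_nonneg hγ0 t) ((hp t).le_one x))

theorem IsPmf.sum_discounted {X : Type*} [Fintype X] {γ : ℝ} (hγ0 : 0 ≤ γ) (hγ1 : γ < 1)
    {p : ℕ → X → ℝ} (hp : ∀ t, IsPmf (p t)) :
    ∑ x, (1 - γ) * ∑' t, γ ^ t * p t x = 1 := by
  rw [← mul_sum, ← Summable.tsum_finsetSum fun x _ => summable_discounted hγ0 hγ1 hp x]
  simp only [← mul_sum, (hp _).2, mul_one]
  rw [tsum_geometric_of_lt_one hγ0 hγ1, mul_inv_cancel₀ (sub_pos.2 hγ1).ne']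

theorem hasSum_discounted_linear {γ : ℝ} (α : ℝ) (hγ0 : 0 ≤ γ) (hγ1 : γ < 1) :
    HasSum (fun t : ℕ => 2 * α * (t * γ ^ t)) (2 * α * (γ / (1 - γ) ^ 2)) := by
  have hnorm : ‖γ‖ < 1 := by rwa [Real.norm_eq_abs, abs_of_nonneg hγ0]
  exact (hasSum_coe_mul_geometric_of_norm_lt_one hnorm).mul_left (2 * α)

/-- If the total variation distance grows at most linearly in time with rate `α`, then discounted
mixtures are at distance at most `α * γ / (1 - γ)`. -/
theorem TV_discounted_le {X : Type*} [Fintype X] {γ α : ℝ} (hγ0 : 0 ≤ γ) (hγ1 : γ < 1)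
    {p q : ℕ → X → ℝ} (hp : ∀ t, IsPmf (p t)) (hq : ∀ t, IsPmf (q t))
    (hpq : ∀ t : ℕ, TV (p t) (q t) ≤ t * α) :
    TV (fun x => (1 - γ) * ∑' t, γ ^ t * p t x) (fun x => (1 - γ) * ∑' t, γ ^ t * q t x) ≤
      α * γ / (1 - γ) := by
  have hpos : 0 < 1 - γ := sub_pos.2 hγ1
  have hsum : ∀ x, Summable fun t => |γ ^ t * (p t x - q t x)| := fun x => by
    simpa only [← mul_sub] using
      ((IsPmf.summable_discounted hγ0 hγ1 hp x).sub
        (IsPmf.summable_discounted hγ0 hγ1 hq x)).abs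
  have hgeom := hasSum_discounted_linear α hγ0 hγ1
  have hdiff : ∑ x, |∑' t, γ ^ t * p t x - ∑' t, γ ^ t * q t x| ≤ 2 * α * (γ / (1 - γ) ^ 2) :=
    calc ∑ x, |∑' t, γ ^ t * p t x - ∑' t, γ ^ t * q t x|
        ≤ ∑ x, ∑' t, |γ ^ t * (p t x - q t x)| := by
          gcongr with x
          rw [← (IsPmf.summable_discounted hγ0 hγ1 hp x).tsum_sub
            (IsPmf.summable_discounted hγ0 hγ1 hq x)]
          simp only [← mul_sub]
          simp only [← Real.norm_eq_abs] at hsum ⊢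
          exact norm_tsum_le_tsum_norm (hsum x)
      _ = ∑' t, ∑ x, |γ ^ t * (p t x - q t x)| :=
          (Summable.tsum_finsetSum fun x _ => hsum x).symm
      _ ≤ 2 * α * (γ / (1 - γ) ^ 2) := by
          rw [← hgeom.tsum_eq]
          refine Summable.tsum_le_tsum (fun t => ?_) (summable_sum fun x _ => hsum x)
            hgeom.summable
          have ht := hpq t
          rw [TV] at ht
          simp only [abs_mul, abs_of_nonneg (pow_nonneg hγ0 t), ← mul_sum]
          calc γ ^ t * ∑ x, |p t x - q t x|
              ≤ γ ^ t * (2 * (t * α)) := by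
                have := pow_nonneg hγ0 t
                gcongr
                linarith
            _ = 2 * α * (t * γ ^ t) := by ring
  simp only [TV, ← mul_sub, abs_mul, abs_of_pos hpos, ← mul_sum]
  calc 1 / 2 * ((1 - γ) * ∑ x, |∑' t, γ ^ t * p t x - ∑' t, γ ^ t * q t x|)
      ≤ 1 / 2 * ((1 - γ) * (2 * α * (γ / (1 - γ) ^ 2))) := by gcongr
    _ = α * γ / (1 - γ) := by field_simp

/-- Lemma 1 (simultaneous policy and model deviation) for a finite MDP. -/
theorem vmail_lemma1 {S A : Type*} [Fintype S] [Fintype A] [Nonempty S] [Nonempty A]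
    (γ α Rmax : ℝ) (hγ0 : 0 ≤ γ) (hγ1 : γ < 1) (hα : 0 ≤ α) (hR : 0 ≤ Rmax)
    (π : S → A → ℝ) (hπ : ∀ s, IsPmf (π s))
    (T That : S → A → S → ℝ)
    (hT : ∀ s a, IsPmf (T s a)) (hThat : ∀ s a, IsPmf (That s a))
    (hTVmodel : ∀ s a, TV (T s a) (That s a) ≤ α)
    (μ₀ : S → ℝ) (hμ₀ : IsPmf μ₀)
    (μ μhat : ℕ → S → ℝ)
    (hμ0 : μ 0 = μ₀) (hμhat0 : μhat 0 = μ₀)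
    (hμstep : ∀ t s', μ (t + 1) s' = ∑ s, ∑ a, μ t s * π s a * T s a s')
    (hμhatstep : ∀ t s', μhat (t + 1) s' = ∑ s, ∑ a, μhat t s * π s a * That s a s')
    (ν νhat : ℕ → S × A → ℝ)
    (hν : ∀ t s a, ν t (s, a) = μ t s * π s a)
    (hνhat : ∀ t s a, νhat t (s, a) = μhat t s * π s a)
    (ρ ρhat : S × A → ℝ)
    (hρ : ∀ sa, ρ sa = (1 - γ) * ∑' t : ℕ, γ ^ t * ν t sa)
    (hρhat : ∀ sa, ρhat sa = (1 - γ) * ∑' t : ℕ, γ ^ t * νhat t sa)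
    (ρE : S × A → ℝ) (hρE : IsPmf ρE)
    (r : S × A → ℝ) (hr : ∀ sa, 0 ≤ r sa ∧ r sa ≤ Rmax)
    (J JE : ℝ)
    (hJ : J = (1 - γ)⁻¹ * ∑ sa, ρ sa * r sa)
    (hJE : JE = (1 - γ)⁻¹ * ∑ sa, ρE sa * r sa) :
    |JE - J| ≤ (Rmax / (1 - γ)) * TV ρhat ρE + α * Rmax / (1 - γ) ^ 2 := by
  have hpos : 0 < 1 - γ := sub_pos.2 hγ1
  obtain rfl : ν = fun t x => μ t x.1 * π x.1 x.2 := by ext t ⟨s, a⟩; exact hν t s a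
  obtain rfl : νhat = fun t x => μhat t x.1 * π x.1 x.2 := by ext t ⟨s, a⟩; exact hνhat t s a
  obtain rfl := funext hρ
  obtain rfl := funext hρhat
  have hstep : ∀ t, μ (t + 1) = fun s' =>
      ∑ x : S × A, μ t x.1 * π x.1 x.2 * T x.1 x.2 s' := fun t => by
    ext s'; rw [hμstep, Fintype.sum_prod_type]
  have hstephat : ∀ t, μhat (t + 1) = fun s' =>
      ∑ x : S × A, μhat t x.1 * π x.1 x.2 * That x.1 x.2 s' := fun t => by
    ext s'; rw [hμhatstep, Fintype.sum_prod_type]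
  have hμ : ∀ t, IsPmf (μ t) := fun t => by
    induction t with
    | zero => rwa [hμ0]
    | succ t ih => rw [hstep]; exact (ih.joint hπ).bind fun x => hT x.1 x.2
  have hμhat : ∀ t, IsPmf (μhat t) := fun t => by
    induction t with
    | zero => rwa [hμhat0]
    | succ t ih => rw [hstephat]; exact (ih.joint hπ).bind fun x => hThat x.1 x.2
  have hdrift : ∀ t : ℕ, TV (μ t) (μhat t) ≤ t * α := fun t => by
    induction t with
    | zero => simp [hμ0, hμhat0, TV]
    | succ t ih =>
      rw [hstep, hstephat]
      refine (TV_bind_le ((hμ t).joint hπ) (fun x => hThat x.1 x.2)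
        fun x => hTVmodel x.1 x.2).trans ?_
      rw [TV_joint _ _ hπ]
      push_cast
      linarith
  have hmodel := TV_discounted_le hγ0 hγ1 (fun t => (hμ t).joint hπ)
    (fun t => (hμhat t).joint hπ) (fun t => (TV_joint _ _ hπ).trans_le (hdrift t))
  have hmass := IsPmf.sum_discounted hγ0 hγ1 fun t => (hμ t).joint hπ
  have hmodel' : α * γ / (1 - γ) ≤ α / (1 - γ) := by
    gcongr
    exact mul_le_of_le_one_right hα hγ1.le
  rw [hJ, hJE, ← mul_sub, abs_mul, abs_of_pos (inv_pos.2 hpos)]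
  refine (mul_le_mul_of_nonneg_left
    ((abs_sum_mul_sub_sum_mul_le (hρE.2.trans hmass.symm) hr).trans
      (mul_le_mul_of_nonneg_left ((TV_comm _ _).trans_le ((TV_triangle _ _ _).trans
        (add_le_add_left (hmodel.trans hmodel') _))) hR)) (inv_pos.2 hpos).le).trans_eq ?_
  field_simp
  ring
end

section
/- Let Z, S, A be finite nonempty types, γ ∈ [0,1), R_max ≥ 0. Let ρ_π and ρ_E be pmfs on Z × A, and let P : Z → (S → ℝ) assign to each z a pmf P z on S (the shared belief-to-state kernel). Define the state-action marginals ρ_π^{SA}(s,a) = ∑_z ρ_π(z,a)·P z s and ρ_E^{SA}(s,a) = ∑_z ρ_E(z,a)·P z s. Let r : S × A → ℝ satisfy 0 ≤ r(s,a) ≤ R_max for all (s,a), and define J_π = (1−γ)⁻¹·∑_{s,a} ρ_π^{SA}(s,a)·r(s,a) and J_E = (1−γ)⁻¹·∑_{s,a} ρ_E^{SA}(s,a)·r(s,a). Then |J_E − J_π| ≤ (R_max/(1−γ))·TV(ρ_π, ρ_E), where TV is taken between the latent-space distributions ρ_π and ρ_E on Z × A. -/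
open Finset

/-- The average of a function with values in `[0, R]` under a pmf lies in `[0, R]`. -/
theorem IsPmf.sum_mul_mem_Icc {S : Type*} [Fintype S] {p f : S → ℝ} {R : ℝ} (hp : IsPmf p)
    (hf : ∀ s, f s ∈ Set.Icc 0 R) : ∑ s, p s * f s ∈ Set.Icc 0 R := by
  refine ⟨sum_nonneg fun s _ => mul_nonneg (hp.1 s) (hf s).1, ?_⟩
  calc ∑ s, p s * f s ≤ ∑ s, p s * R :=
        sum_le_sum fun s _ => mul_le_mul_of_nonneg_left (hf s).2 (hp.1 s)
    _ = R := by rw [← sum_mul, hp.2, one_mul]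

/-- Means of a function with values in `[0, R]` differ by at most `R` times the total variation. -/
theorem IsPmf.abs_sum_mul_sub_le_mul_TV {S : Type*} [Fintype S] {p q f : S → ℝ} {R : ℝ}
    (hp : IsPmf p) (hq : IsPmf q) (hf : ∀ s, f s ∈ Set.Icc 0 R) :
    |∑ s, q s * f s - ∑ s, p s * f s| ≤ R * TV p q := by
  have centered : ∑ s, q s * f s - ∑ s, p s * f s = ∑ s, (q s - p s) * (f s - R / 2) := by
    simp only [sub_mul, mul_sub, sum_sub_distrib, ← sum_mul, hp.2, hq.2]
    ring
  rw [centered]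
  calc |∑ s, (q s - p s) * (f s - R / 2)| ≤ ∑ s, |(q s - p s) * (f s - R / 2)| :=
        abs_sum_le_sum_abs _ _
    _ ≤ ∑ s, |p s - q s| * (R / 2) := by
        refine sum_le_sum fun s _ => ?_
        rw [abs_mul, abs_sub_comm (q s)]
        refine mul_le_mul_of_nonneg_left (abs_le.2 ?_) (abs_nonneg _)
        constructor <;> linarith [(hf s).1, (hf s).2]
    _ = R * TV p q := by
        rw [← sum_mul, TV]
        ring

/-- Averaging `r` over the state-action marginal of `ρ` is averaging the latent reward over `ρ`. -/
theorem sum_marginal_mul_eq {Z S A : Type*} [Fintype Z] [Fintype S] [Fintype A]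
    (ρ : Z × A → ℝ) (P : Z → S → ℝ) (r : S × A → ℝ) :
    ∑ sa : S × A, (∑ z, ρ (z, sa.2) * P z sa.1) * r sa =
      ∑ za : Z × A, ρ za * ∑ s, P za.1 s * r (s, za.2) := by
  simp only [Fintype.sum_prod_type_right, sum_mul, mul_sum]
  refine sum_congr rfl fun a _ => ?_
  rw [sum_comm]
  simp only [mul_assoc]

/-- Latent-space divergence bounds true state-action suboptimality. -/
theorem vmail_latent_suboptimality {Z S A : Type*}
    [Fintype Z] [Fintype S] [Fintype A] [Nonempty Z] [Nonempty S] [Nonempty A]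
    (γ Rmax : ℝ) (hγ0 : 0 ≤ γ) (hγ1 : γ < 1) (hR : 0 ≤ Rmax)
    (ρπ ρE : Z × A → ℝ) (hρπ : IsPmf ρπ) (hρE : IsPmf ρE)
    (P : Z → S → ℝ) (hP : ∀ z, IsPmf (P z))
    (r : S × A → ℝ) (hr : ∀ sa, 0 ≤ r sa ∧ r sa ≤ Rmax)
    (Jπ JE : ℝ)
    (hJπ : Jπ = (1 - γ)⁻¹ * ∑ sa : S × A, (∑ z, ρπ (z, sa.2) * P z sa.1) * r sa)
    (hJE : JE = (1 - γ)⁻¹ * ∑ sa : S × A, (∑ z, ρE (z, sa.2) * P z sa.1) * r sa) :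
    |JE - Jπ| ≤ (Rmax / (1 - γ)) * TV ρπ ρE := by
  have hγ : 0 ≤ (1 - γ)⁻¹ := inv_nonneg.2 (by linarith)
  rw [hJπ, hJE, sum_marginal_mul_eq, sum_marginal_mul_eq, ← mul_sub, abs_mul, abs_of_nonneg hγ]
  calc _ ≤ (1 - γ)⁻¹ * (Rmax * TV ρπ ρE) :=
        mul_le_mul_of_nonneg_left (hρπ.abs_sum_mul_sub_le_mul_TV hρE fun za =>
          (hP za.1).sum_mul_mem_Icc fun s => hr (s, za.2)) hγ
    _ = Rmax / (1 - γ) * TV ρπ ρE := by ring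
end

section
/- Let V and W be finite nonempty types and let f : ℝ → ℝ be convex on [0, ∞). Let p and q be pmfs on V with q strictly positive, and let K : V → (W → ℝ) assign to each v a strictly positive pmf K v on W. Define the pushforward distributions p''(w) = ∑_v p(v)·K v w and q''(w) = ∑_v q(v)·K v w. Then D_f(p'' ‖ q'') ≤ D_f(p ‖ q). -/
open Finset

/-- `p` is a strictly positive probability mass function on the finite type `S`. -/
def IsPosPmf {S : Type*} [Fintype S] (p : S → ℝ) : Prop :=
  (∀ s, 0 < p s) ∧ ∑ s, p s = 1

/-- The f-divergence between pmfs on a finite type. -/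
noncomputable def fDiv {S : Type*} [Fintype S] (f : ℝ → ℝ) (p q : S → ℝ) : ℝ :=
  ∑ s, q s * f (p s / q s)

/-- Jensen's inequality in perspective form: a generalized log-sum inequality. -/
theorem ConvexOn.sum_mul_map_div_le {ι : Type*} {t : Finset ι} {f : ℝ → ℝ}
    (hf : ConvexOn ℝ (Set.Ici (0 : ℝ)) f) (ht : t.Nonempty) {a b : ι → ℝ}
    (ha : ∀ i ∈ t, 0 ≤ a i) (hb : ∀ i ∈ t, 0 < b i) :
    (∑ i ∈ t, b i) * f ((∑ i ∈ t, a i) / ∑ i ∈ t, b i) ≤ ∑ i ∈ t, b i * f (a i / b i) := by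
  have hpos : 0 < ∑ i ∈ t, b i := Finset.sum_pos hb ht
  have hsum : ∑ i ∈ t, b i * (a i / b i) = ∑ i ∈ t, a i :=
    Finset.sum_congr rfl fun i hi => mul_div_cancel₀ _ (hb i hi).ne'
  have h := hf.map_centerMass_le (t := t) (w := b) (p := fun i => a i / b i)
    (fun i hi => (hb i hi).le) hpos (fun i hi => div_nonneg (ha i hi) (hb i hi).le)
  simp only [Finset.centerMass, smul_eq_mul, Function.comp_apply, hsum] at h
  rwa [inv_mul_eq_div, inv_mul_eq_div, le_div_iff₀' hpos] at h

/-- Data-processing inequality for f-divergences under a common Markov kernel. -/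
theorem fDiv_data_processing {V W : Type*} [Fintype V] [Fintype W] [Nonempty V] [Nonempty W]
    (f : ℝ → ℝ) (hf : ConvexOn ℝ (Set.Ici (0 : ℝ)) f)
    (p q : V → ℝ) (hp : IsPmf p) (hq : IsPosPmf q)
    (K : V → W → ℝ) (hK : ∀ v, IsPosPmf (K v)) :
    fDiv f (fun w : W => ∑ v, p v * K v w) (fun w : W => ∑ v, q v * K v w) ≤ fDiv f p q := by
  calc
    ∑ w, (∑ v, q v * K v w) * f ((∑ v, p v * K v w) / ∑ v, q v * K v w)
      ≤ ∑ w, ∑ v, q v * K v w * f (p v * K v w / (q v * K v w)) :=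
        Finset.sum_le_sum fun w _ => hf.sum_mul_map_div_le Finset.univ_nonempty
          (fun v _ => mul_nonneg (hp.1 v) ((hK v).1 w).le)
          (fun v _ => mul_pos (hq.1 v) ((hK v).1 w))
    _ = ∑ v, ∑ w, q v * f (p v / q v) * K v w := by
        rw [Finset.sum_comm]
        refine Finset.sum_congr rfl fun v _ => Finset.sum_congr rfl fun w _ => ?_
        rw [mul_div_mul_right _ _ ((hK v).1 w).ne', mul_right_comm]
    _ = ∑ v, q v * f (p v / q v) := by
        simp only [← Finset.mul_sum, (hK _).2, mul_one]
end

section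
/- Let X, Z, A be finite nonempty types, let T ≥ 1 be a natural number, let x : Fin T → X be a sequence of observations, a : Fin T → A a sequence of actions, and z₀ : Z a fixed initial latent state. Let U : Z → (X → ℝ) assign to each latent state a strictly positive pmf on X (observation model), let Tr : Z → A → (Z → ℝ) assign to each latent state and action a strictly positive pmf on Z (latent transition model), and let q : Z → A → X → (Z → ℝ) assign to each previous latent state, action, and current observation a strictly positive pmf on Z (inference model). For a latent trajectory ζ : Fin T → Z, write prev ζ t = z₀ if t = 0 and prev ζ t = ζ(t−1) otherwise; define the weight w(ζ) = ∏_{t} U(ζ t)(x t)·Tr(prev ζ t)(a t)(ζ t), the likelihood L = ∑_{ζ : Fin T → Z} w(ζ), and the variational trajectory distribution Q(ζ) = ∏_{t} q(prev ζ t)(a t)(x t)(ζ t). Then Real.log L ≥ ∑_{ζ} Q(ζ)·∑_{t} ( Real.log (U(ζ t)(x t)) − Real.log ( q(prev ζ t)(a t)(x t)(ζ t) / Tr(prev ζ t)(a t)(ζ t) ) ). -/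
open Finset

/-- The previous latent state along a latent trajectory `ζ`, with fixed
initial latent state `z₀` at time 0. -/
def prevLatent {Z : Type*} {T : ℕ} (z₀ : Z) (ζ : Fin T → Z) (t : Fin T) : Z :=
  if h : (t : ℕ) = 0 then z₀ else ζ ⟨(t : ℕ) - 1, by have := t.isLt; omega⟩

theorem prevLatent_cons_zero {Z : Type*} {T : ℕ} (z₀ z : Z) (ζ : Fin T → Z) :
    prevLatent z₀ (Fin.cons z ζ : Fin (T + 1) → Z) 0 = z₀ := by
  simp [prevLatent]

theorem prevLatent_cons_succ {Z : Type*} {T : ℕ} (z₀ z : Z) (ζ : Fin T → Z) (t : Fin T) :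
    prevLatent z₀ (Fin.cons z ζ : Fin (T + 1) → Z) t.succ = prevLatent z ζ t := by
  obtain ⟨_ | n, hn⟩ := t
  · rfl
  · rfl

/-- The trajectory weights of a time-inhomogeneous Markov chain sum to one. -/
theorem sum_prod_prevLatent_eq_one {Z : Type*} [Fintype Z] {T : ℕ} (k : Fin T → Z → Z → ℝ)
    (hk : ∀ t z, ∑ z', k t z z' = 1) (z₀ : Z) :
    ∑ ζ : Fin T → Z, ∏ t, k t (prevLatent z₀ ζ t) (ζ t) = 1 := by
  induction T generalizing z₀ with
  | zero => simp
  | succ T ih =>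
    rw [← (Fin.consEquiv fun _ : Fin (T + 1) => Z).sum_comp, Fintype.sum_prod_type]
    simp only [Fin.consEquiv, Equiv.coe_fn_mk, Fin.prod_univ_succ, prevLatent_cons_zero,
      prevLatent_cons_succ, Fin.cons_zero, Fin.cons_succ, ← mul_sum]
    simp [ih (fun t => k t.succ) (fun t => hk t.succ), hk]

/-- The Gibbs form of Jensen's inequality for the logarithm. -/
theorem sum_mul_log_div_le_log_sum {ι : Type*} [Fintype ι] {p w : ι → ℝ}
    (hp : IsPosPmf p) (hw : ∀ i, 0 < w i) :
    ∑ i, p i * Real.log (w i / p i) ≤ Real.log (∑ i, w i) := by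
  have h := strictConcaveOn_log_Ioi.concaveOn.le_map_sum (t := univ) (w := p)
    (p := fun i => w i / p i) (fun i _ => (hp.1 i).le) hp.2
    (fun i _ => div_pos (hw i) (hp.1 i))
  simpa only [smul_eq_mul, mul_div_cancel₀ _ (hp.1 _).ne'] using h

/-- Sequential evidence lower bound (ELBO) for a latent-variable dynamics model. -/
theorem sequential_elbo {X Z A : Type*} [Fintype X] [Fintype Z] [Fintype A]
    [Nonempty X] [Nonempty Z] [Nonempty A]
    (T : ℕ) (hT : 1 ≤ T)
    (x : Fin T → X) (a : Fin T → A) (z₀ : Z)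
    (U : Z → X → ℝ) (hU : ∀ z, IsPosPmf (U z))
    (Tr : Z → A → Z → ℝ) (hTr : ∀ z act, IsPosPmf (Tr z act))
    (q : Z → A → X → Z → ℝ) (hq : ∀ z act obs, IsPosPmf (q z act obs))
    (w : (Fin T → Z) → ℝ)
    (hw : ∀ ζ, w ζ = ∏ t, U (ζ t) (x t) * Tr (prevLatent z₀ ζ t) (a t) (ζ t))
    (L : ℝ) (hL : L = ∑ ζ : Fin T → Z, w ζ)
    (Q : (Fin T → Z) → ℝ)
    (hQ : ∀ ζ, Q ζ = ∏ t, q (prevLatent z₀ ζ t) (a t) (x t) (ζ t)) :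
    Real.log L ≥
      ∑ ζ : Fin T → Z, Q ζ *
        ∑ t, (Real.log (U (ζ t) (x t)) -
          Real.log (q (prevLatent z₀ ζ t) (a t) (x t) (ζ t) /
            Tr (prevLatent z₀ ζ t) (a t) (ζ t))) := by
  have hQ_pmf : IsPosPmf Q := by
    refine ⟨fun ζ => ?_, ?_⟩
    · rw [hQ]
      exact prod_pos fun t _ => (hq _ _ _).1 _
    · simp only [hQ]
      exact sum_prod_prevLatent_eq_one (fun t z => q z (a t) (x t)) (fun _ _ => (hq _ _ _).2) z₀
  have hw_pos (ζ) : 0 < w ζ := by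
    rw [hw]
    exact prod_pos fun t _ => mul_pos ((hU _).1 _) ((hTr _ _).1 _)
  rw [ge_iff_le, hL]
  refine le_of_eq_of_le (sum_congr rfl fun ζ _ => ?_) (sum_mul_log_div_le_log_sum hQ_pmf hw_pos)
  congr 1
  have hU_ne (t) := ((hU (ζ t)).1 (x t)).ne'
  have hTr_ne (t) := ((hTr (prevLatent z₀ ζ t) (a t)).1 (ζ t)).ne'
  have hq_ne (t) := ((hq (prevLatent z₀ ζ t) (a t) (x t)).1 (ζ t)).ne'
  rw [hw, hQ, ← prod_div_distrib,
    Real.log_prod fun t _ => div_ne_zero (mul_ne_zero (hU_ne t) (hTr_ne t)) (hq_ne t)]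
  refine sum_congr rfl fun t _ => ?_
  rw [Real.log_div (hq_ne t) (hTr_ne t),
    Real.log_div (mul_ne_zero (hU_ne t) (hTr_ne t)) (hq_ne t), Real.log_mul (hU_ne t) (hTr_ne t)]
  ring
end
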